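/- Let 𝒦_ℓ be the class of CAT(0) disc retracts whose marked boundary curves S¹ → W are ℓ-Lipschitz. Then 𝒦_ℓ is uniformly totally bounded: there exists a function N: (0,∞) → ℕ such that every space in 𝒦_ℓ admits an ε-net with at most N(ε) points; consequently 𝒦_ℓ is precompact in the Gromov–Hausdorff topology. -/

import Mathlib

open Set MeasureTheory NNReal ENNReal


open Set MeasureTheory NNReal ENNReal

/-- A (complete geodesic) `CAT(0)` space: midpoints exist, and the
Bruhat–Tits `CN` comparison inequality holds. -/
def IsCAT0 (W : Type*) [MetricSpace W] : Prop :=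
  (∀ x y : W, ∃ m : W, dist x m = dist x y / 2 ∧ dist m y = dist x y / 2) ∧
  ∀ x y z m : W, dist y m = dist y z / 2 → dist m z = dist y z / 2 →
    dist x m ^ 2 ≤ (dist x y ^ 2 + dist x z ^ 2) / 2 - dist y z ^ 2 / 4

/-- The gluing relation of the mapping cylinder of `δ : S¹ → W`:
`δ u` is identified with `(u, 0)`. -/
def MappingCylinderRel {W : Type*} (δ : Circle → W) :
    (W ⊕ Circle × unitInterval) → (W ⊕ Circle × unitInterval) → Prop :=
  fun a b => ∃ u : Circle, a = Sum.inl (δ u) ∧ b = Sum.inr (u, 0)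

/-- `W` is a disc retract with boundary curve `δ : S¹ → W` if the mapping
cylinder of `δ` is homeomorphic to the closed disc. -/
def IsDiscRetract (W : Type*) [TopologicalSpace W] (δ : Circle → W) : Prop :=
  Nonempty (Quot (MappingCylinderRel δ) ≃ₜ (Metric.closedBall (0 : ℂ) 1 : Set ℂ))

section SweepOut

open unitInterval

/-- A complex-valued function on a topological space has a continuous logarithm. -/
def HasContinuousLog {X : Type*} [TopologicalSpace X] (f : X → ℂ) : Prop :=
  ∃ g : X → ℂ, Continuous g ∧ ∀ x, Complex.exp (g x) = f x

theorem hasContinuousLog_const {X : Type*} [TopologicalSpace X] {c : ℂ} (hc : c ≠ 0) :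
    HasContinuousLog fun _ : X => c :=
  ⟨fun _ => Complex.log c, continuous_const, fun _ => Complex.exp_log hc⟩

theorem HasContinuousLog.comp {X Y : Type*} [TopologicalSpace X] [TopologicalSpace Y]
    {f : X → ℂ} (hf : HasContinuousLog f) {h : Y → X} (hh : Continuous h) :
    HasContinuousLog fun y => f (h y) := by
  obtain ⟨g, hg, hgf⟩ := hf
  exact ⟨g ∘ h, hg.comp hh, fun y => hgf (h y)⟩

/-- Having a continuous logarithm is invariant under homotopies through nonvanishing functions. -/
theorem HasContinuousLog.of_homotopy {X : Type*} [TopologicalSpace X] {H : I × X → ℂ}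
    (hH : Continuous H) (hne : ∀ q, H q ≠ 0) (h0 : HasContinuousLog fun x => H (0, x)) :
    HasContinuousLog fun x => H (1, x) := by
  obtain ⟨g, hg, hgf⟩ := h0
  let H' : C(I × X, {z : ℂ // z ≠ 0}) := ⟨fun q => ⟨H q, hne q⟩, hH.subtype_mk _⟩
  have h0' : ∀ x, H' (0, x) = ⟨_, (g x).exp_ne_zero⟩ := fun x => Subtype.ext (hgf x).symm
  let L := Complex.isCoveringMap_exp.liftHomotopy H' ⟨g, hg⟩ h0'
  refine ⟨fun x => L (1, x), by fun_prop, fun x => ?_⟩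
  exact congrArg Subtype.val
    (congrFun (Complex.isCoveringMap_exp.liftHomotopy_lifts H' ⟨g, hg⟩ h0') (1, x))

theorem Circle.exists_eq_neg {f : Circle → ℝ} (hf : Continuous f) : ∃ u, f u = f (-u) := by
  have hneg : Continuous fun u : Circle => -u := by
    exact continuous_induced_rng.2 (continuous_neg.comp continuous_subtype_val)
  have hc : Continuous fun u => f u - f (-u) := hf.sub (hf.comp hneg)
  have key : (0 : ℝ) ∈ range fun u => f u - f (-u) := by
    rcases le_total (f 1 - f (-1)) 0 with h | h
    · exact mem_range_of_exists_le_of_exists_ge hc ⟨1, h⟩ ⟨-1, by rw [neg_neg]; linarith⟩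
    · exact mem_range_of_exists_le_of_exists_ge hc ⟨-1, by rw [neg_neg]; linarith⟩ ⟨1, h⟩
  obtain ⟨u, hu⟩ := key
  exact ⟨u, sub_eq_zero.1 hu⟩

theorem Circle.not_injective_of_continuous {f : Circle → ℝ} (hf : Continuous f) :
    ¬ Function.Injective f := fun hinj => by
  obtain ⟨u, hu⟩ := Circle.exists_eq_neg hf
  have h1 : (u : ℂ) = -u := congrArg (fun v : Circle => (v : ℂ)) (hinj hu)
  exact u.coe_ne_zero (self_eq_neg.1 h1)

theorem Circle.surjective_of_continuous_injective {g : Circle → Circle} (hg : Continuous g)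
    (hinj : Function.Injective g) : Function.Surjective g := by
  by_contra hs
  obtain ⟨a, ha⟩ := not_forall.1 hs
  push Not at ha
  refine Circle.not_injective_of_continuous (f := fun v => Complex.arg (-(g v * a⁻¹) : Circle)) ?_ ?_
  · rw [continuous_iff_continuousAt]
    intro v
    have h1 : ContinuousAt (fun v => ((-(g v * a⁻¹) : Circle) : ℂ)) v := by
      have : Continuous fun v => -((g v * a⁻¹ : Circle) : ℂ) := by fun_prop
      exact this.continuousAt
    refine ContinuousAt.comp (g := Complex.arg) (Complex.continuousAt_arg ?_) h1
    rw [Complex.mem_slitPlane_iff_arg]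
    refine ⟨fun h => ha v ?_, Circle.coe_ne_zero _⟩
    have h2 : (-(g v * a⁻¹) : Circle) = -1 := Circle.injective_arg (by simpa using h)
    have h3 := neg_injective h2
    rwa [mul_inv_eq_one] at h3
  · intro v w h
    have h2 := neg_injective (Circle.injective_arg h)
    exact hinj (mul_right_cancel h2)

theorem Circle.not_hasContinuousLog_coe : ¬ HasContinuousLog fun v : Circle => (v : ℂ) := by
  rintro ⟨g, hg, hgf⟩
  have hre : ∀ v, (g v).re = 0 := fun v => by
    have := congrArg norm (hgf v)
    rw [Complex.norm_exp, Circle.norm_coe, Real.exp_eq_one_iff] at this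
    exact this
  refine Circle.not_injective_of_continuous (Complex.continuous_im.comp hg) fun v w h => ?_
  have h1 : g v = g w := Complex.ext (by rw [hre, hre]) h
  exact Circle.ext ((hgf v).symm.trans (h1 ▸ hgf w))

theorem Circle.not_hasContinuousLog_coe_sub {z : ℂ} (hz : ‖z‖ < 1) :
    ¬ HasContinuousLog fun v : Circle => (v : ℂ) - z := fun h => by
  refine Circle.not_hasContinuousLog_coe ?_
  have := HasContinuousLog.of_homotopy
    (H := fun q : I × Circle => (q.2 : ℂ) - ((σ q.1 : ℝ) : ℂ) * z) (by fun_prop) ?_ (by simpa using h)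
  · simpa using this
  · rintro ⟨t, v⟩ h0
    have h1 : ‖(v : ℂ)‖ = ‖((σ t : ℝ) : ℂ) * z‖ := congrArg norm (sub_eq_zero.1 h0)
    rw [Circle.norm_coe, norm_mul, Complex.norm_real, Real.norm_of_nonneg (σ t).2.1] at h1
    nlinarith [(σ t).2.1, (σ t).2.2, norm_nonneg z]

section MappingCylinder

variable {W : Type*} {δ : Circle → W}

/-- The map from the mapping cylinder to the plane that collapses the base to `0` and is
polar coordinates on the collar. -/
def cylinderPolar (δ : Circle → W) : Quot (MappingCylinderRel δ) → ℂ :=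
  Quot.lift (Sum.elim (fun _ => 0) fun q => ((q.2 : ℝ) : ℂ) * q.1) <| by
    rintro _ _ ⟨u, rfl, rfl⟩
    simp

/-- The canonical retraction of the mapping cylinder onto its base. -/
def cylinderRetract (δ : Circle → W) : Quot (MappingCylinderRel δ) → W :=
  Quot.lift (Sum.elim id fun q => δ q.1) <| by
    rintro _ _ ⟨u, rfl, rfl⟩
    rfl

/-- The deformation of the mapping cylinder that scales the collar coordinate. -/
def cylinderScale (δ : Circle → W) (s : I) :
    Quot (MappingCylinderRel δ) → Quot (MappingCylinderRel δ) :=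
  Quot.lift (Sum.elim (fun w => Quot.mk _ (Sum.inl w)) fun q => Quot.mk _ (Sum.inr (q.1, s * q.2))) <| by
    rintro _ _ ⟨u, rfl, rfl⟩
    exact Quot.sound ⟨u, rfl, by simp⟩

theorem cylinderPolar_scale (s : I) (m : Quot (MappingCylinderRel δ)) :
    cylinderPolar δ (cylinderScale δ s m) = ((s : ℝ) : ℂ) * cylinderPolar δ m := by
  obtain ⟨w | q, rfl⟩ := Quot.exists_rep m
  · simp [cylinderPolar, cylinderScale]
  · simp [cylinderPolar, cylinderScale, mul_assoc]

theorem cylinderScale_one (m : Quot (MappingCylinderRel δ)) : cylinderScale δ 1 m = m := by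
  obtain ⟨w | q, rfl⟩ := Quot.exists_rep m <;> simp [cylinderScale]

theorem cylinderScale_zero (m : Quot (MappingCylinderRel δ)) :
    cylinderScale δ 0 m = Quot.mk _ (Sum.inl (cylinderRetract δ m)) := by
  obtain ⟨w | q, rfl⟩ := Quot.exists_rep m
  · rfl
  · exact (Quot.sound ⟨q.1, rfl, by simp⟩ : Quot.mk (MappingCylinderRel δ) _ = _).symm

theorem norm_cylinderPolar_le_one (m : Quot (MappingCylinderRel δ)) :
    ‖cylinderPolar δ m‖ ≤ 1 := by
  obtain ⟨w | q, rfl⟩ := Quot.exists_rep m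
  · simp [cylinderPolar]
  · simpa [cylinderPolar, abs_of_nonneg q.2.2.1, Circle.norm_coe] using q.2.2.2

theorem eq_of_cylinderPolar_eq_coe {m : Quot (MappingCylinderRel δ)} {u : Circle}
    (h : cylinderPolar δ m = u) : m = Quot.mk _ (Sum.inr (u, 1)) := by
  obtain ⟨w | ⟨v, t⟩, rfl⟩ := Quot.exists_rep m
  · exact absurd h.symm u.coe_ne_zero
  · have h' : ((t : ℝ) : ℂ) * v = u := h
    have ht : (t : ℝ) = 1 := by
      simpa [abs_of_nonneg t.2.1, Circle.norm_coe] using congrArg norm h'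
    have ht' : t = 1 := Subtype.ext ht
    subst ht'
    have : v = u := Circle.ext (by simpa using h')
    rw [this]

variable [TopologicalSpace W]

theorem continuous_cylinderRetract (hδ : Continuous δ) : Continuous (cylinderRetract δ) :=
  continuous_quot_lift _ <| continuous_id.sumElim (by fun_prop)

theorem continuous_cylinderScale [CompactSpace W] [T2Space (Quot (MappingCylinderRel δ))] :
    Continuous fun q : I × Quot (MappingCylinderRel δ) => cylinderScale δ q.1 q.2 := by
  have hq : Topology.IsQuotientMap
      (Prod.map id (Quot.mk _) : I × (W ⊕ Circle × I) → I × Quot (MappingCylinderRel δ)) :=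
    .of_surjective_continuous (Function.surjective_id.prodMap Quot.mk_surjective)
      (continuous_id.prodMap continuous_quot_mk)
  rw [hq.continuous_iff]
  rw [← (Homeomorph.prodSumDistrib (X := I) (Y := W) (Z := Circle × I)).symm.comp_continuous_iff']
  rw [continuous_sum_dom]
  constructor
  · exact (continuous_quot_mk.comp (continuous_inl.comp continuous_snd))
  · refine continuous_quot_mk.comp (continuous_inr.comp
      (f := fun q : I × (Circle × I) => (q.2.1, q.1 * q.2.2)) ?_)
    fun_prop

/-- If the base of a mapping cylinder is contractible and the cylinder is a disc, then the free
end of the collar lies on the boundary circle of the disc. -/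
theorem norm_collar_end_eq_one [CompactSpace W] (hδ : Continuous δ)
    (φ : Quot (MappingCylinderRel δ) ≃ₜ (Metric.closedBall (0 : ℂ) 1 : Set ℂ))
    {p : W} {Γ : W × I → W} (hΓ : Continuous Γ) (hΓ0 : ∀ x, Γ (x, 0) = p)
    (hΓ1 : ∀ x, Γ (x, 1) = x) (u : Circle) :
    ‖(φ (Quot.mk _ (Sum.inr (u, 1))) : ℂ)‖ = 1 := by
  have : T2Space (Quot (MappingCylinderRel δ)) := φ.symm.t2Space
  set z := φ (Quot.mk _ (Sum.inr (u, 1)))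
  have hz1 : ‖(z : ℂ)‖ ≤ 1 := mem_closedBall_zero_iff.1 z.2
  by_contra hne
  have hlt : 0 < 1 - ‖(z : ℂ)‖ := sub_pos.2 (lt_of_le_of_ne hz1 hne)
  set r := 1 - ‖(z : ℂ)‖ with hr
  have hmem : ∀ v : Circle, (z : ℂ) + r * v ∈ Metric.closedBall (0 : ℂ) 1 := fun v => by
    rw [mem_closedBall_zero_iff]
    refine (norm_add_le _ _).trans ?_
    rw [norm_mul, Circle.norm_coe, Complex.norm_real, Real.norm_of_nonneg hlt.le]
    linarith
  let γ : Circle → Quot (MappingCylinderRel δ) := fun v => φ.symm ⟨_, hmem v⟩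
  have hγ : Continuous γ := φ.symm.continuous.comp (by fun_prop)
  have hφγ : ∀ v, (φ (γ v) : ℂ) - z = r * v := fun v => by simp [γ]
  have hrne : (r : ℂ) ≠ 0 := Complex.ofReal_ne_zero.2 hlt.ne'
  have hsub : ∀ m, (φ m : ℂ) - z = 0 → m = Quot.mk _ (Sum.inr (u, 1)) := fun m hm =>
    φ.injective (Subtype.ext (sub_eq_zero.1 hm))
  have hbase : ∀ w, (φ (Quot.mk _ (Sum.inl w)) : ℂ) - z ≠ 0 := fun w hw => by
    have := congrArg (cylinderPolar δ) (hsub _ hw)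
    exact u.coe_ne_zero (by simpa [cylinderPolar] using this.symm)
  have hlog1 : HasContinuousLog fun v : Circle =>
      (φ (Quot.mk _ (Sum.inl (cylinderRetract δ (γ v)))) : ℂ) - z := by
    have hret := continuous_cylinderRetract hδ
    have := HasContinuousLog.of_homotopy (H := fun q : I × Circle =>
      (φ (Quot.mk _ (Sum.inl (Γ (cylinderRetract δ (γ q.2), q.1)))) : ℂ) - z)
      (by
        have h1 : Continuous fun q : I × Circle =>
            (Quot.mk (MappingCylinderRel δ) (Sum.inl (Γ (cylinderRetract δ (γ q.2), q.1)))) :=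
          continuous_quot_mk.comp (by fun_prop)
        fun_prop)
      (fun q => hbase _) (by simpa only [hΓ0] using hasContinuousLog_const (hbase p))
    simpa only [hΓ1] using this
  have hlog2 : HasContinuousLog fun v : Circle => (φ (γ v) : ℂ) - z := by
    have hsc := continuous_cylinderScale (δ := δ)
    have := HasContinuousLog.of_homotopy (H := fun q : I × Circle =>
      (φ (cylinderScale δ q.1 (γ q.2)) : ℂ) - z)
      (by
        have h1 : Continuous fun q : I × Circle => cylinderScale δ q.1 (γ q.2) :=
          hsc.comp (f := fun q : I × Circle => (q.1, γ q.2)) (by fun_prop)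
        fun_prop)
      (fun q hq => by
        obtain ⟨s, v⟩ := q
        have h1 := congrArg (cylinderPolar δ) (hsub _ hq)
        have h2 : ((s : ℝ) : ℂ) * cylinderPolar δ (γ v) = u := by
          rw [← cylinderPolar_scale, h1]; simp [cylinderPolar]
        have h3 : (s : ℝ) * ‖cylinderPolar δ (γ v)‖ = 1 := by
          simpa [abs_of_nonneg s.2.1, Circle.norm_coe] using congrArg norm h2
        have h4 : (s : ℝ) = 1 := by
          nlinarith [s.2.1, s.2.2, norm_cylinderPolar_le_one (γ v)]
        have h5 : s = 1 := Subtype.ext h4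
        have h6 := hφγ v
        dsimp only at hq
        rw [h5, cylinderScale_one, h6] at hq
        exact mul_ne_zero hrne v.coe_ne_zero hq)
      (by simpa only [cylinderScale_zero] using hlog1)
    simpa only [cylinderScale_one] using this
  simp only [hφγ] at hlog2
  obtain ⟨g, hg, hgf⟩ := hlog2
  refine Circle.not_hasContinuousLog_coe
    ⟨fun v => g v - Complex.log r, hg.sub continuous_const, fun v => ?_⟩
  rw [Complex.exp_sub, hgf, Complex.exp_log hrne, mul_div_cancel_left₀ _ hrne]

/-- A nullhomotopy of the boundary curve of a contractible disc retract is surjective. -/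
theorem IsDiscRetract.exists_eq_of_nullhomotopy [CompactSpace W] (hδ : Continuous δ)
    (hW : IsDiscRetract W δ) {p : W} {Γ : W × I → W} (hΓ : Continuous Γ)
    (hΓ0 : ∀ x, Γ (x, 0) = p) (hΓ1 : ∀ x, Γ (x, 1) = x) (w : W) :
    ∃ v t, Γ (δ v, t) = w := by
  obtain ⟨φ⟩ := hW
  by_contra! hw
  have hbd := norm_collar_end_eq_one hδ φ hΓ hΓ0 hΓ1
  let b : Circle → Circle := fun u =>
    ⟨φ (Quot.mk _ (Sum.inr (u, 1))), mem_sphere_zero_iff_norm.2 (hbd u)⟩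
  have hcol : Continuous fun q : Circle × I => Quot.mk (MappingCylinderRel δ) (Sum.inr q) :=
    continuous_quot_mk.comp continuous_inr
  have hbase : Continuous fun x : W => Quot.mk (MappingCylinderRel δ) (Sum.inl x) :=
    continuous_quot_mk.comp continuous_inl
  have hb : Continuous b := by
    refine Continuous.subtype_mk ?_ _
    have h1 : Continuous fun u : Circle => Quot.mk (MappingCylinderRel δ) (Sum.inr (u, 1)) :=
      hcol.comp (f := fun u : Circle => (u, (1 : I))) (by fun_prop)
    fun_prop
  have hbinj : Function.Injective b := fun u v h => by
    have h1 := φ.injective (Subtype.ext (congrArg (fun v : Circle => (v : ℂ)) h))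
    have h2 := congrArg (cylinderPolar δ) h1
    exact Circle.ext (by simpa [cylinderPolar] using h2)
  have hbsurj := Circle.surjective_of_continuous_injective hb hbinj
  let e : Circle ≃ₜ Circle :=
    Continuous.homeoOfEquivCompactToT2 (f := Equiv.ofBijective b ⟨hbinj, hbsurj⟩) hb
  set z := φ (Quot.mk _ (Sum.inl w))
  have hsub : ∀ m, (φ m : ℂ) - z = 0 → m = Quot.mk _ (Sum.inl w) := fun m hm =>
    φ.injective (Subtype.ext (sub_eq_zero.1 hm))
  have hinl : ∀ x, (φ (Quot.mk _ (Sum.inl x)) : ℂ) - z = 0 → x = w := fun x hx =>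
    congrArg (cylinderRetract δ) (hsub _ hx)
  have hzlt : ‖(z : ℂ)‖ < 1 := by
    refine lt_of_le_of_ne (mem_closedBall_zero_iff.1 z.2) fun h1 => ?_
    obtain ⟨u, hu⟩ := hbsurj ⟨z, mem_sphere_zero_iff_norm.2 h1⟩
    have h2 := hsub (Quot.mk _ (Sum.inr (u, 1))) (sub_eq_zero.2 (congrArg (fun v : Circle => (v : ℂ)) hu))
    have h3 := congrArg (cylinderPolar δ) h2
    simp [cylinderPolar] at h3
  have hglue : ∀ v, Quot.mk (MappingCylinderRel δ) (Sum.inr (v, 0)) = Quot.mk _ (Sum.inl (δ v)) :=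
    fun v => (Quot.sound ⟨v, rfl, rfl⟩ : Quot.mk (MappingCylinderRel δ) _ = _).symm
  have hlog1 : HasContinuousLog fun v : Circle => (φ (Quot.mk _ (Sum.inl (δ v))) : ℂ) - z := by
    have := HasContinuousLog.of_homotopy
      (H := fun q : I × Circle => (φ (Quot.mk _ (Sum.inl (Γ (δ q.2, q.1)))) : ℂ) - z)
      (by
        have h1 : Continuous fun q : I × Circle =>
            (Quot.mk (MappingCylinderRel δ) (Sum.inl (Γ (δ q.2, q.1)))) :=
          hbase.comp (by fun_prop)
        fun_prop)
      (fun q hq => hw _ _ (hinl _ hq))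
      (by
        simp only [hΓ0]
        exact hasContinuousLog_const fun hp => hw 1 0 ((hΓ0 _).trans (hinl _ hp)))
    simpa only [hΓ1] using this
  have hlog2 : HasContinuousLog fun v : Circle => (b v : ℂ) - z := by
    refine HasContinuousLog.of_homotopy
      (H := fun q : I × Circle => (φ (Quot.mk _ (Sum.inr (q.2, q.1))) : ℂ) - z)
      (by
        have h1 : Continuous fun q : I × Circle =>
            (Quot.mk (MappingCylinderRel δ) (Sum.inr (q.2, q.1))) :=
          hcol.comp (f := fun q : I × Circle => (q.2, q.1)) (by fun_prop)
        fun_prop)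
      (fun q hq => ?_) (by simpa only [hglue] using hlog1)
    obtain ⟨t, v⟩ := q
    have h1 := hsub _ hq
    have h2 : δ v = w := congrArg (cylinderRetract δ) h1
    exact hw v 1 ((hΓ1 _).trans h2)
  have hlog3 := hlog2.comp e.symm.continuous
  refine Circle.not_hasContinuousLog_coe_sub hzlt ?_
  convert hlog3 using 3 with v
  exact congrArg (fun v : Circle => (v : ℂ)) (e.apply_symm_apply v).symm

end MappingCylinder

section CAT0

variable {W : Type*} [MetricSpace W]

/-- Weighted barycenters of two points in a compact `CAT(0)` space, as minimizers of a uniformly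
convex energy. -/
theorem IsCAT0.exists_weighted_barycenter [CompactSpace W] (hW : IsCAT0 W) (p x : W) (t : I) :
    ∃ m, ∀ y, (1 - t) * dist m p ^ 2 + t * dist m x ^ 2 + dist m y ^ 2 / 2 ≤
      (1 - t) * dist y p ^ 2 + t * dist y x ^ 2 := by
  obtain ⟨m, -, hm⟩ := isCompact_univ.exists_isMinOn ⟨p, mem_univ p⟩
    (f := fun y => (1 - (t : ℝ)) * dist y p ^ 2 + t * dist y x ^ 2) (by fun_prop)
  refine ⟨m, fun y => ?_⟩
  obtain ⟨c, hc1, hc2⟩ := hW.1 m y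
  have h1 := hW.2 p m y c hc1 hc2
  have h2 := hW.2 x m y c hc1 hc2
  have h3 := hm (mem_univ c)
  simp only [mem_ofPred_eq] at h3
  rw [dist_comm p, dist_comm p, dist_comm p] at h1
  rw [dist_comm x, dist_comm x, dist_comm x] at h2
  nlinarith [mul_le_mul_of_nonneg_left h1 (sub_nonneg.2 t.2.2), mul_le_mul_of_nonneg_left h2 t.2.1]

/-- A compact `CAT(0)` space contracts to each of its points, with Hölder control depending only
on the distance to the point. -/
theorem IsCAT0.exists_contraction [CompactSpace W] (hW : IsCAT0 W) (p : W) :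
    ∃ Γ : W × I → W, (∀ x, Γ (x, 0) = p) ∧ (∀ x, Γ (x, 1) = x) ∧
      (∀ D x t, dist x p ≤ D → dist (Γ (x, t)) p ≤ 2 * D) ∧
      ∀ D x y t s, dist x p ≤ D → dist y p ≤ D →
        dist (Γ (x, t)) (Γ (y, s)) ^ 2 ≤ 13 * D ^ 2 * dist t s + 10 * D * dist x y := by
  choose m hm using hW.exists_weighted_barycenter p
  have hbound : ∀ D x t, dist x p ≤ D → dist (m x t) p ≤ 2 * D ∧ dist (m x t) x ≤ 2 * D := by
    intro D x t hx
    have h1 := hm x t p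
    have h2 := hm x t x
    have hD : 0 ≤ D := dist_nonneg.trans hx
    have hsq : dist x p ^ 2 ≤ D ^ 2 := pow_le_pow_left₀ dist_nonneg hx 2
    rw [dist_self, dist_comm p x] at h1
    rw [dist_self] at h2
    have ha := mul_nonneg (sub_nonneg.2 t.2.2) (sq_nonneg (dist (m x t) p))
    have hb := mul_nonneg t.2.1 (sq_nonneg (dist (m x t) x))
    have hc := mul_nonneg (sub_nonneg.2 t.2.2) (sq_nonneg (dist x p))
    have hd := mul_nonneg t.2.1 (sq_nonneg (dist x p))
    constructor <;> refine abs_le_of_sq_le_sq' ?_ (by linarith) |>.2 <;> nlinarith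
  refine ⟨fun q => m q.1 q.2, fun x => ?_, fun x => ?_, fun D x t hx => (hbound D x t hx).1,
    fun D x y t s hx hy => ?_⟩
  · have := hm x 0 p
    simp only [Icc.coe_zero, dist_self] at this
    exact dist_le_zero.1 (by dsimp only; nlinarith)
  · have := hm x 1 x
    simp only [Icc.coe_one, dist_self] at this
    exact dist_le_zero.1 (by dsimp only; nlinarith)
  · obtain ⟨ha, hax⟩ := hbound D x t hx
    obtain ⟨hb, hby⟩ := hbound D y s hy
    have h1 := hm x t (m y s)
    have h2 := hm y s (m x t)
    dsimp only
    set a := m x t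
    set b := m y s
    rw [dist_comm b a] at h2
    have hD : 0 ≤ D := dist_nonneg.trans hx
    have hay : dist a y ≤ 3 * D := by
      linarith [dist_triangle a p y, dist_comm y p]
    have hbx : dist b x ≤ 3 * D := by
      linarith [dist_triangle b p x, dist_comm x p]
    have hdiff : ∀ c, |dist c x - dist c y| ≤ dist x y := fun c => by
      rw [dist_comm c x, dist_comm c y]; exact abs_dist_sub_le x y c
    have hfac : ∀ c, dist c x + dist c y ≤ 5 * D →
        |dist c x ^ 2 - dist c y ^ 2| ≤ 5 * D * dist x y := fun c hc => by
      rw [sq_sub_sq, abs_mul, abs_of_nonneg (by positivity)]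
      exact mul_le_mul hc (hdiff c) (abs_nonneg _) (by positivity)
    have hA := hfac a (by linarith)
    have hB := hfac b (by linarith)
    have hts : dist t s = |(t : ℝ) - s| := rfl
    have s1 := pow_le_pow_left₀ dist_nonneg ha 2
    have s2 := pow_le_pow_left₀ dist_nonneg hb 2
    have s3 := pow_le_pow_left₀ dist_nonneg hay 2
    have s4 := pow_le_pow_left₀ dist_nonneg hby 2
    have hR : |(dist a p ^ 2 - dist b p ^ 2) + (dist b y ^ 2 - dist a y ^ 2)| ≤ 13 * D ^ 2 := by
      rw [abs_le]
      constructor <;> nlinarith [sq_nonneg (dist a p), sq_nonneg (dist b p),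
        sq_nonneg (dist a y), sq_nonneg (dist b y)]
    have hT : ((t : ℝ) - s) *
        ((dist a p ^ 2 - dist b p ^ 2) + (dist b y ^ 2 - dist a y ^ 2)) ≤
          13 * D ^ 2 * |(t : ℝ) - s| := by
      refine (le_abs_self _).trans ?_
      rw [abs_mul, mul_comm]
      exact mul_le_mul_of_nonneg_right hR (abs_nonneg _)
    have hX : t * ((dist b x ^ 2 - dist b y ^ 2) - (dist a x ^ 2 - dist a y ^ 2)) ≤
        10 * D * dist x y := by
      have := abs_le.1 hA
      have := abs_le.1 hB
      have h0 : 0 ≤ 10 * D * dist x y := by positivity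
      nlinarith [t.2.1, t.2.2]
    rw [hts]
    linarith

/-- The contraction of a compact `CAT(0)` disc retract sweeps out the whole space by Hölder
curves, with constants depending only on the Lipschitz constant of the boundary curve. -/
theorem IsCAT0.exists_sweepout [CompactSpace W] (hW : IsCAT0 W) {δ : Circle → W}
    (hδ : IsDiscRetract W δ) {ℓ : ℝ≥0} (hl : LipschitzWith ℓ δ) :
    ∃ G : Circle × I → W, Function.Surjective G ∧ (∀ q, dist (G q) (δ 1) ≤ 4 * ℓ) ∧
      ∀ q r, dist (G q) (G r) ^ 2 ≤ 72 * ℓ ^ 2 * dist q r := by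
  obtain ⟨Γ, hΓ0, hΓ1, hΓp, hΓd⟩ := hW.exists_contraction (δ 1)
  have hΓ : Continuous Γ := by
    obtain ⟨C, hC⟩ := Metric.isBounded_iff.1 (isCompact_univ (X := W)).isBounded
    have hCp : ∀ x, dist x (δ 1) ≤ C := fun x => hC (mem_univ _) (mem_univ _)
    refine continuous_iff_continuousAt.2 fun q => ?_
    rw [ContinuousAt, tendsto_iff_dist_tendsto_zero]
    have hlim : Filter.Tendsto
        (fun r : W × I => √(13 * C ^ 2 * dist r.2 q.2 + 10 * C * dist r.1 q.1))
        (nhds q) (nhds 0) := by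
      have : Continuous fun r : W × I =>
          √(13 * C ^ 2 * dist r.2 q.2 + 10 * C * dist r.1 q.1) := by fun_prop
      simpa using this.tendsto q
    exact squeeze_zero (fun _ => dist_nonneg)
      (fun r => Real.le_sqrt_of_sq_le (hΓd C r.1 q.1 r.2 q.2 (hCp _) (hCp _))) hlim
  have hD : ∀ v, dist (δ v) (δ 1) ≤ 2 * ℓ := fun v => by
    have h1 := hl.dist_le_mul v 1
    have h2 : dist v 1 ≤ 2 := by
      change dist (v : ℂ) ((1 : Circle) : ℂ) ≤ 2
      rw [dist_eq_norm]
      refine (norm_sub_le _ _).trans ?_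
      rw [Circle.norm_coe, Circle.norm_coe]
      norm_num
    nlinarith [ℓ.2]
  refine ⟨fun q => Γ (δ q.1, q.2), fun w => ?_, fun q => ?_, fun q r => ?_⟩
  · obtain ⟨v, t, h⟩ := hδ.exists_eq_of_nullhomotopy hl.continuous hΓ hΓ0 hΓ1 w
    exact ⟨(v, t), h⟩
  · linarith [hΓp _ _ q.2 (hD q.1)]
  · have h1 := hΓd _ _ _ q.2 r.2 (hD q.1) (hD r.1)
    have h2 := hl.dist_le_mul q.1 r.1
    have h3 : dist q.1 r.1 ≤ dist q r := le_max_left _ _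
    have h4 : dist q.2 r.2 ≤ dist q r := le_max_right _ _
    have h5 : (0 : ℝ) ≤ ℓ := ℓ.2
    calc _ ≤ _ := h1
      _ ≤ 13 * (2 * ℓ) ^ 2 * dist q r + 10 * (2 * ℓ) * (ℓ * dist q r) := by
          gcongr
          exact h2.trans (by gcongr)
      _ = _ := by ring

end CAT0

theorem exists_card_bound_of_disc_retract (ℓ : ℝ≥0) (ε : ℝ) :
    ∃ n : ℕ, ∀ (W : Type) [MetricSpace W] [CompactSpace W],
      ∀ δ : Circle → W, IsCAT0 W → IsDiscRetract W δ → LipschitzWith ℓ δ →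
        0 < ε → ∃ S : Finset W, S.card ≤ n ∧ ∀ w : W, ∃ s ∈ S, dist w s ≤ ε := by
  classical
  by_cases hε : 0 < ε
  swap
  · exact ⟨0, fun W _ _ δ _ _ _ h => absurd h hε⟩
  have hη : 0 < ε ^ 2 / (72 * ℓ ^ 2 + 1) := by positivity
  obtain ⟨T, -, hT, hcov⟩ :=
    (isCompact_univ (X := Circle × I)).finite_cover_balls hη
  refine ⟨hT.toFinset.card, fun W _ _ δ hW hδ hl _ => ?_⟩
  obtain ⟨G, hG, -, hGd⟩ := hW.exists_sweepout hδ hl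
  refine ⟨hT.toFinset.image G, Finset.card_image_le, fun w => ?_⟩
  obtain ⟨q, rfl⟩ := hG w
  obtain ⟨r, hr, hqr⟩ := mem_iUnion₂.1 (hcov (mem_univ q))
  refine ⟨G r, Finset.mem_image_of_mem _ (hT.mem_toFinset.2 hr), ?_⟩
  have h1 := hGd q r
  have h2 := (lt_div_iff₀ (by positivity)).1 (Metric.mem_ball.1 hqr)
  refine (abs_le_of_sq_le_sq' ?_ hε.le).2
  nlinarith [dist_nonneg (x := q) (y := r)]

end SweepOut

/-- the class `𝒦_ℓ` of `CAT(0)` disc retracts with `ℓ`-Lipschitz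
marked boundary curves is uniformly totally bounded -- there is `N : (0,∞) → ℕ`
such that every member admits an `ε`-net with at most `N ε` points -- and
consequently the corresponding set of isometry classes is precompact (totally
bounded) in the Gromov--Hausdorff space. -/
theorem K_ell_uniformly_totally_bounded (ℓ : ℝ≥0) :
    (∃ N : ℝ → ℕ, ∀ (W : Type) [MetricSpace W] [CompactSpace W],
      ∀ δ : Circle → W, IsCAT0 W → IsDiscRetract W δ → LipschitzWith ℓ δ →
        ∀ ε : ℝ, 0 < ε → ∃ S : Finset W, S.card ≤ N ε ∧
          ∀ w : W, ∃ s ∈ S, dist w s ≤ ε) ∧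
    TotallyBounded {p : GromovHausdorff.GHSpace |
      ∃ (W : Type) (_ : MetricSpace W) (_ : CompactSpace W) (_ : Nonempty W)
        (δ : Circle → W), IsCAT0 W ∧ IsDiscRetract W δ ∧ LipschitzWith ℓ δ ∧
          p = GromovHausdorff.toGHSpace W} := by
  choose N hN using exists_card_bound_of_disc_retract ℓ
  refine ⟨⟨N, fun W _ _ δ hW hδ hl ε hε => hN ε W δ hW hδ hl hε⟩, ?_⟩
  refine GromovHausdorff.totallyBounded (C := 8 * ℓ) (u := fun n : ℕ => 1 / ((n : ℝ) + 1))
    (K := fun n => N (1 / ((n : ℝ) + 1) / 2)) tendsto_one_div_add_atTop_nhds_zero_nat ?_ ?_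
  · rintro p ⟨W, _, _, _, δ, hW, hδ, hl, hp⟩
    rw [← p.toGHSpace_rep, GromovHausdorff.toGHSpace_eq_toGHSpace_iff_isometryEquiv] at hp
    obtain ⟨e⟩ := hp
    obtain ⟨G, hG, hGp, -⟩ := hW.exists_sweepout hδ hl
    refine Metric.diam_le_of_forall_dist_le (by positivity) fun x _ y _ => ?_
    obtain ⟨q, hq⟩ := hG (e x)
    obtain ⟨r, hr⟩ := hG (e y)
    rw [← e.dist_eq, ← hq, ← hr]
    linarith [dist_triangle_right (G q) (G r) (δ 1), hGp q, hGp r]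
  · rintro p ⟨W, _, _, _, δ, hW, hδ, hl, hp⟩ n
    rw [← p.toGHSpace_rep, GromovHausdorff.toGHSpace_eq_toGHSpace_iff_isometryEquiv] at hp
    obtain ⟨e⟩ := hp
    have hpos : 0 < 1 / ((n : ℝ) + 1) := by positivity
    obtain ⟨S, hS, hcov⟩ := hN (1 / ((n : ℝ) + 1) / 2) W δ hW hδ hl (half_pos hpos)
    refine ⟨e.symm '' S, ?_, fun x _ => ?_⟩
    · refine Cardinal.mk_image_le.trans ?_
      simpa using hS
    · obtain ⟨s, hs, hd⟩ := hcov (e x)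
      refine mem_iUnion₂.2 ⟨e.symm s, mem_image_of_mem _ hs, ?_⟩
      rw [Metric.mem_ball, ← e.dist_eq, e.apply_symm_apply]
      linarith
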